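/- arXiv:2301.09898 — 2 statements merged into one kernel-verified Lean document; each statement's English description precedes it below -/
import Mathlib

section
/- Let α ∈ ℝ with 0 < 3α² ≤ 1, let b > 0, λ ∈ ℝ, γ > 0, and let V(η) = η²/2 + α·η³ + η⁴/4 be the FPU-α potential. Set β_c = b·(24·(|λ|+γ)·|α|)^{−1}. Then for every β ∈ (0, β_c) the partition function Z_{β,b,λ} is finite, and sup_{0<β<β_c} ∫_ℝ e^{γ|η|} dν_{β,b,λ}(η) < ∞. -/
open MeasureTheory

/-- The unnormalized Gibbs density `exp(-b V_β(η) + λ η)` with `V_β(η) = β⁻² V(βη)`. -/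
noncomputable def gibbsDensity (V : ℝ → ℝ) (β b lam : ℝ) (η : ℝ) : ℝ :=
  Real.exp (-b * (V (β * η) / β ^ 2) + lam * η)

/-- The partition function `Z_{β,b,λ}`. -/
noncomputable def partitionZ (V : ℝ → ℝ) (β b lam : ℝ) : ℝ :=
  ∫ η : ℝ, gibbsDensity V β b lam η

/-- The Gibbs probability measure `ν_{β,b,λ}`. -/
noncomputable def gibbsMeasure (V : ℝ → ℝ) (β b lam : ℝ) : Measure ℝ :=
  (volume : Measure ℝ).withDensity
    (fun η => ENNReal.ofReal (gibbsDensity V β b lam η / partitionZ V β b lam))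

/-- The FPU-α potential `V(η) = η²/2 + α η³ + η⁴/4`. -/
noncomputable def fpuPotential (α : ℝ) (η : ℝ) : ℝ :=
  η ^ 2 / 2 + α * η ^ 3 + η ^ 4 / 4

lemma fpuPotential_rescaled (α η : ℝ) {β : ℝ} (hβ : 0 < β) :
    fpuPotential α (β * η) / β ^ 2 = η ^ 2 / 2 + α * β * η ^ 3 + β ^ 2 * η ^ 4 / 4 := by
  unfold fpuPotential
  field_simp

/-- The rescaled potential is bounded below by a quadratic, uniformly in `β`. -/
lemma sq_div_six_le_rescaled {α : ℝ} (hα : 3 * α ^ 2 ≤ 1) {β : ℝ} (hβ : 0 < β) (η : ℝ) :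
    η ^ 2 / 6 ≤ fpuPotential α (β * η) / β ^ 2 := by
  rw [fpuPotential_rescaled α η hβ]
  nlinarith [sq_nonneg (η * (α + β * η / 2)), mul_nonneg (sub_nonneg.2 hα) (sq_nonneg η)]

/-- Completing the square: a linear term is absorbed by half of the quadratic `b η² / 6`. -/
lemma mul_abs_sub_sq_le {b : ℝ} (hb : 0 < b) (s η : ℝ) :
    s * |η| - b * (η ^ 2 / 6) ≤ 3 * s ^ 2 / b + -(b / 12) * η ^ 2 := by
  have h : 3 * s ^ 2 / b + -(b / 12) * η ^ 2 - (s * |η| - b * (η ^ 2 / 6))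
      = (6 * s - b * |η|) ^ 2 / (12 * b) := by
    rw [← sq_abs η]
    field_simp
    ring
  have : 0 ≤ (6 * s - b * |η|) ^ 2 / (12 * b) := by positivity
  linarith

/-- Gaussian domination of the exponentially weighted density, uniformly in `β`. -/
lemma exp_mul_gibbsDensity_le {α b : ℝ} (hα : 3 * α ^ 2 ≤ 1) (hb : 0 < b) (lam γ : ℝ)
    {β : ℝ} (hβ : 0 < β) (η : ℝ) :
    Real.exp (γ * |η|) * gibbsDensity (fpuPotential α) β b lam η
      ≤ Real.exp (3 * (|lam| + γ) ^ 2 / b) * Real.exp (-(b / 12) * η ^ 2) := by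
  rw [gibbsDensity, ← Real.exp_add, ← Real.exp_add, Real.exp_le_exp]
  have h₁ := mul_le_mul_of_nonneg_left (sq_div_six_le_rescaled hα hβ η) hb.le
  have h₂ := mul_abs_sub_sq_le hb (|lam| + γ) η
  have h₃ : lam * η ≤ |lam| * |η| := (le_abs_self _).trans (abs_mul _ _).le
  linarith

lemma gibbsDensity_nonneg (V : ℝ → ℝ) (β b lam η : ℝ) : 0 ≤ gibbsDensity V β b lam η :=
  Real.exp_nonneg _

lemma continuous_gibbsDensity (α β b lam : ℝ) :
    Continuous (gibbsDensity (fpuPotential α) β b lam) := by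
  unfold gibbsDensity fpuPotential
  fun_prop

lemma integrable_gibbsDensity {α b : ℝ} (hα : 3 * α ^ 2 ≤ 1) (hb : 0 < b) (lam : ℝ)
    {β : ℝ} (hβ : 0 < β) : Integrable (gibbsDensity (fpuPotential α) β b lam) := by
  refine ((integrable_exp_neg_mul_sq (b := b / 12) (by positivity)).const_mul
    (Real.exp (3 * (|lam| + 0) ^ 2 / b))).mono'
    (continuous_gibbsDensity α β b lam).aestronglyMeasurable (ae_of_all _ fun η => ?_)
  rw [Real.norm_of_nonneg (gibbsDensity_nonneg _ _ _ _ _)]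
  simpa using exp_mul_gibbsDensity_le hα hb lam 0 hβ η

/-- Lower bound for the density on the unit interval, uniformly in `β ≤ B`. -/
lemma le_gibbsDensity {b : ℝ} (hb : 0 < b) (α lam : ℝ) {β B : ℝ} (hβ : 0 < β)
    (hβB : β ≤ B) {η : ℝ} (hη : η ∈ Set.Icc (0 : ℝ) 1) :
    Real.exp (-b * (1 / 2 + |α| * B + B ^ 2 / 4) - |lam|)
      ≤ gibbsDensity (fpuPotential α) β b lam η := by
  obtain ⟨h₀, h₁⟩ := hη
  rw [gibbsDensity, Real.exp_le_exp, fpuPotential_rescaled α η hβ]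
  have e₁ : α * β * η ^ 3 ≤ |α| * B := by
    calc α * β * η ^ 3 ≤ |α| * B * 1 := by
          gcongr
          · exact mul_nonneg (abs_nonneg α) (hβ.le.trans hβB)
          · exact le_abs_self α
          · exact pow_le_one₀ h₀ h₁
      _ = |α| * B := mul_one _
  have e₂ : β ^ 2 * η ^ 4 ≤ B ^ 2 := by
    calc β ^ 2 * η ^ 4 ≤ B ^ 2 * 1 := by
          gcongr
          exact pow_le_one₀ h₀ h₁
      _ = B ^ 2 := mul_one _
  have e₃ : η ^ 2 ≤ 1 := pow_le_one₀ h₀ h₁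
  have e₄ : -|lam| ≤ lam * η := by
    have : |lam * η| ≤ |lam| := by
      rw [abs_mul, abs_of_nonneg h₀]
      exact mul_le_of_le_one_right (abs_nonneg _) h₁
    linarith [neg_abs_le (lam * η)]
  have e₅ := mul_le_mul_of_nonneg_left (show
    η ^ 2 / 2 + α * β * η ^ 3 + β ^ 2 * η ^ 4 / 4 ≤ 1 / 2 + |α| * B + B ^ 2 / 4 by linarith) hb.le
  linarith

/-- Lower bound for the partition function, uniformly in `β ≤ B`. -/
lemma le_partitionZ {α b : ℝ} (hα : 3 * α ^ 2 ≤ 1) (hb : 0 < b) (lam : ℝ) {β B : ℝ}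
    (hβ : 0 < β) (hβB : β ≤ B) :
    Real.exp (-b * (1 / 2 + |α| * B + B ^ 2 / 4) - |lam|)
      ≤ partitionZ (fpuPotential α) β b lam := by
  have hint := integrable_gibbsDensity hα hb lam hβ
  calc Real.exp (-b * (1 / 2 + |α| * B + B ^ 2 / 4) - |lam|)
      = ∫ _ in Set.Icc (0 : ℝ) 1, Real.exp (-b * (1 / 2 + |α| * B + B ^ 2 / 4) - |lam|) := by
        simp
    _ ≤ ∫ η in Set.Icc (0 : ℝ) 1, gibbsDensity (fpuPotential α) β b lam η :=
        setIntegral_mono_on (by simp) hint.integrableOn measurableSet_Icc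
          fun η hη => le_gibbsDensity hb α lam hβ hβB hη
    _ ≤ partitionZ (fpuPotential α) β b lam :=
        setIntegral_le_integral hint (ae_of_all _ fun η => gibbsDensity_nonneg _ _ _ _ η)

/-- For the FPU-α potential `V(η) = η²/2 + α η³ + η⁴/4` with `0 < 3α² ≤ 1`, `b > 0`,
`λ ∈ ℝ`, `γ > 0` and `β_c = b (24(|λ|+γ)|α|)⁻¹`: for every `β ∈ (0, β_c)` the partition
function `Z_{β,b,λ}` is finite, and the exponential moments
`∫ e^{γ|η|} dν_{β,b,λ}` are bounded uniformly over `0 < β < β_c`. -/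
theorem fpu_uniform_exponential_moment_bound
    (α b lam γ : ℝ) (hα : 0 < 3 * α ^ 2) (hα' : 3 * α ^ 2 ≤ 1) (hb : 0 < b) (hγ : 0 < γ)
    (V : ℝ → ℝ) (hV : V = fun η : ℝ => η ^ 2 / 2 + α * η ^ 3 + η ^ 4 / 4)
    (βc : ℝ) (hβc : βc = b * (24 * (|lam| + γ) * |α|)⁻¹) :
    (∀ β ∈ Set.Ioo (0 : ℝ) βc, Integrable (gibbsDensity V β b lam)) ∧
    ∃ C : ℝ, ∀ β ∈ Set.Ioo (0 : ℝ) βc,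
      (∫⁻ η : ℝ, ENNReal.ofReal (Real.exp (γ * |η|)) ∂(gibbsMeasure V β b lam))
        ≤ ENNReal.ofReal C := by
  obtain rfl : V = fpuPotential α := hV
  refine ⟨fun β hβ => integrable_gibbsDensity hα' hb lam hβ.1,
    ∫ η : ℝ, Real.exp (3 * (|lam| + γ) ^ 2 / b) * Real.exp (-(b / 12) * η ^ 2)
      / Real.exp (-b * (1 / 2 + |α| * βc + βc ^ 2 / 4) - |lam|), fun β hβ => ?_⟩
  have hmeas := (continuous_gibbsDensity α β b lam).measurable
  rw [gibbsMeasure, lintegral_withDensity_eq_lintegral_mul _ (by fun_prop) (by fun_prop),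
    ofReal_integral_eq_lintegral_ofReal
      (((integrable_exp_neg_mul_sq (by positivity)).const_mul _).div_const _)
      (ae_of_all _ fun η => by positivity)]
  refine lintegral_mono fun η => ?_
  have hZ := le_partitionZ hα' hb lam hβ.1 hβ.2.le
  rw [Pi.mul_apply, mul_comm, ← ENNReal.ofReal_mul (Real.exp_nonneg _), ← mul_div_assoc]
  apply ENNReal.ofReal_le_ofReal
  exact div_le_div₀ (by positivity) (exp_mul_gibbsDensity_le hα' hb lam γ hβ.1 η)
    (Real.exp_pos _) hZ
end

section
/- Fix b > 0 and λ ∈ ℝ. There exist constants C > 0 and β_c ∈ (0,1] such that for all β ∈ (0, β_c), the Gibbs measure ν_{β,b,λ} is well defined and ∫_ℝ |β^{−1}·V'(βη) − η − (1/2)·V'''(0)·β·η²| dν_{β,b,λ}(η) ≤ C·β²; that is, the error in the Taylor expansion of ξ = β^{−1}V'(βη) has expectation of order β² uniformly for small β. -/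
open MeasureTheory

/-- A function on `ℝ` vanishing at `0` whose derivative is bounded by `K` on `[-r, r]` is bounded
by `K r` there. -/
lemma abs_le_mul_of_abs_deriv_le {g : ℝ → ℝ} (hg : Differentiable ℝ g) (h0 : g 0 = 0)
    {K r : ℝ} (hr : 0 ≤ r) (hK : ∀ t, |t| ≤ r → |deriv g t| ≤ K) {x : ℝ} (hx : |x| ≤ r) :
    |g x| ≤ K * r := by
  have h := Convex.norm_image_sub_le_of_norm_deriv_le (𝕜 := ℝ) (s := Set.Icc (-r) r) (f := g)
    (C := K) (x := 0) (y := x) (fun t _ => hg t)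
    (fun t ht => by simpa using hK t (abs_le.mpr ht)) (convex_Icc _ _)
    ⟨by linarith, hr⟩ (abs_le.mp hx)
  have hK0 : 0 ≤ K := (abs_nonneg _).trans (hK 0 (by simpa using hr))
  rw [h0] at h
  simp only [sub_zero, Real.norm_eq_abs] at h
  exact h.trans (mul_le_mul_of_nonneg_left hx hK0)

/-- Second order Taylor estimate when the third derivative grows at most exponentially. -/
lemma abs_taylor_two_error_le {f : ℝ → ℝ} (hf : ContDiff ℝ (⊤ : ℕ∞) f) {M γ : ℝ}
    (hM : 0 ≤ M) (hγ : 0 ≤ γ)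
    (h3 : ∀ x, |deriv (deriv (deriv f)) x| ≤ M * Real.exp (γ * |x|)) (x : ℝ) :
    |f x - f 0 - deriv f 0 * x - 1 / 2 * deriv (deriv f) 0 * x ^ 2|
      ≤ M * Real.exp (γ * |x|) * |x| ^ 3 := by
  have hf1 : ContDiff ℝ (⊤ : ℕ∞) (deriv f) := (contDiff_infty_iff_deriv.mp hf).2
  have hf2 : ContDiff ℝ (⊤ : ℕ∞) (deriv (deriv f)) := (contDiff_infty_iff_deriv.mp hf1).2
  have d0 : Differentiable ℝ f := hf.differentiable (by simp)
  have d1 : Differentiable ℝ (deriv f) := hf1.differentiable (by simp)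
  have d2 : Differentiable ℝ (deriv (deriv f)) := hf2.differentiable (by simp)
  have e2 : ∀ t, |t| ≤ |x| →
      |deriv (deriv f) t - deriv (deriv f) 0| ≤ M * Real.exp (γ * |x|) * |x| := by
    intro t ht
    refine abs_le_mul_of_abs_deriv_le (g := fun t => deriv (deriv f) t - deriv (deriv f) 0)
      (d2.sub_const _) (by simp) (abs_nonneg x) (fun s hs => ?_) ht
    rw [deriv_sub_const]
    exact (h3 s).trans (by gcongr)
  have e1 : ∀ t, |t| ≤ |x| →
      |deriv f t - deriv f 0 - deriv (deriv f) 0 * t| ≤ M * Real.exp (γ * |x|) * |x| * |x| := by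
    intro t ht
    have hd : ∀ s, HasDerivAt (fun t => deriv f t - deriv f 0 - deriv (deriv f) 0 * t)
        (deriv (deriv f) s - deriv (deriv f) 0) s := fun s => by
      have h := ((d1 s).hasDerivAt.sub_const (deriv f 0)).sub
        ((hasDerivAt_id s).const_mul (deriv (deriv f) 0))
      rw [mul_one] at h
      exact h
    refine abs_le_mul_of_abs_deriv_le (fun s => (hd s).differentiableAt) (by simp)
      (abs_nonneg x) (fun s hs => ?_) ht
    rw [(hd s).deriv]
    exact e2 s hs
  have hd : ∀ s, HasDerivAt
      (fun t => f t - f 0 - deriv f 0 * t - 1 / 2 * deriv (deriv f) 0 * t ^ 2)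
      (deriv f s - deriv f 0 - deriv (deriv f) 0 * s) s := fun s => by
    have h := (((d0 s).hasDerivAt.sub_const (f 0)).sub
      ((hasDerivAt_id s).const_mul (deriv f 0))).sub
      (((hasDerivAt_id s).pow 2).const_mul (1 / 2 * deriv (deriv f) 0))
    refine HasDerivAt.congr_deriv h ?_
    simp only [id, Nat.cast_ofNat, mul_one]
    ring
  have e0 := abs_le_mul_of_abs_deriv_le (fun s => (hd s).differentiableAt) (by simp)
    (abs_nonneg x) (fun s hs => by rw [(hd s).deriv]; exact e1 s hs) le_rfl
  exact e0.trans (le_of_eq (by ring))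

/-- A convex differentiable function lies above its tangents. -/
lemma ConvexOn.tangent_le {f : ℝ → ℝ} (hc : ConvexOn ℝ Set.univ f) (hd : Differentiable ℝ f)
    (x y : ℝ) : f y + deriv f y * (x - y) ≤ f x := by
  rcases lt_trichotomy x y with h | rfl | h
  · have := hc.slope_le_deriv (Set.mem_univ _) (Set.mem_univ _) h (hd y)
    rw [slope_def_field, div_le_iff₀ (by linarith)] at this
    linarith
  · simp
  · have := hc.deriv_le_slope (Set.mem_univ _) (Set.mem_univ _) h (hd y)
    rw [slope_def_field, le_div_iff₀ (by linarith)] at this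
    linarith

lemma integrable_exp_neg_abs : Integrable (fun x : ℝ => Real.exp (-|x|)) := by
  rw [← integrableOn_univ, ← Set.Iic_union_Ioi (a := (0 : ℝ))]
  refine IntegrableOn.union ?_ ?_
  · refine (integrableOn_exp_Iic 0).congr_fun (fun x hx => ?_) measurableSet_Iic
    rw [abs_of_nonpos hx, neg_neg]
  · refine (integrableOn_exp_neg_Ioi 0).congr_fun (fun x hx => ?_) measurableSet_Ioi
    simp only [abs_of_pos (Set.mem_Ioi.mp hx)]

/-- Near a critical point at `0` with unit second derivative, `V'` is comparable to the identity. -/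
lemma exists_abs_deriv_sub_self_le {V : ℝ → ℝ} (hd : DifferentiableAt ℝ (deriv V) 0)
    (h1 : deriv V 0 = 0) (h2 : deriv (deriv V) 0 = 1) :
    ∃ δ > 0, ∀ y, |y| < δ → |deriv V y - y| ≤ |y| / 2 := by
  have h := hd.hasDerivAt
  rw [h2, hasDerivAt_iff_isLittleO_nhds_zero] at h
  have h' := h.def (c := 1 / 2) (by norm_num)
  obtain ⟨δ, hδ, H⟩ := Metric.eventually_nhds_iff.mp h'
  refine ⟨δ, hδ, fun y hy => ?_⟩
  have := H (y := y) (by simpa using hy)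
  simp only [zero_add, h1, sub_zero, smul_eq_mul, mul_one, Real.norm_eq_abs] at this
  linarith

/-- Linear growth of a rescaled convex potential. -/
lemma linear_le_rescaled {V : ℝ → ℝ} (hc : ConvexOn ℝ Set.univ V) (hd : Differentiable ℝ V)
    (hnonneg : ∀ x, 0 ≤ V x) {δ R β : ℝ} (hR : 0 < R) (hβ : 0 < β) (hδ : β * R < δ)
    (h : ∀ y, |y| < δ → |deriv V y - y| ≤ |y| / 2) (η : ℝ) :
    R * |η| / 2 - 3 / 2 * R ^ 2 ≤ V (β * η) / β ^ 2 := by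
  have hp : 0 < β * R := by positivity
  rw [le_div_iff₀ (by positivity)]
  rcases le_total 0 η with hη | hη
  · have h1 := h (β * R) (by rwa [abs_of_pos hp])
    have h2 := hc.tangent_le hd (β * η) (β * R)
    have h3 := hnonneg (β * R)
    rw [abs_of_pos hp, abs_le] at h1
    rw [abs_of_nonneg hη]
    have hη' : 0 ≤ β * η := by positivity
    nlinarith [mul_nonneg hη' (by linarith : 0 ≤ deriv V (β * R) - β * R / 2),
      mul_nonneg hp.le (by linarith : 0 ≤ 3 / 2 * (β * R) - deriv V (β * R))]
  · have h1 := h (-(β * R)) (by rwa [abs_neg, abs_of_pos hp])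
    have h2 := hc.tangent_le hd (β * η) (-(β * R))
    have h3 := hnonneg (-(β * R))
    rw [abs_neg, abs_of_pos hp, abs_le] at h1
    rw [abs_of_nonpos hη]
    have hη' : 0 ≤ β * -η := mul_nonneg hβ.le (by linarith)
    nlinarith [mul_nonneg hη' (by linarith : 0 ≤ -deriv V (-(β * R)) - β * R / 2),
      mul_nonneg hp.le (by linarith : 0 ≤ 3 / 2 * (β * R) + deriv V (-(β * R)))]

/-- Quadratic upper bound of a rescaled convex potential on `[0, 1]`. -/
lemma rescaled_le {V : ℝ → ℝ} (hc : ConvexOn ℝ Set.univ V) (hd : Differentiable ℝ V)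
    (hV0 : V 0 = 0) {δ β : ℝ} (hβ : 0 < β) (hδ : β < δ)
    (h : ∀ y, |y| < δ → |deriv V y - y| ≤ |y| / 2) {η : ℝ} (hη : η ∈ Set.Icc (0 : ℝ) 1) :
    V (β * η) / β ^ 2 ≤ 3 / 2 := by
  have hη' : 0 ≤ β * η := mul_nonneg hβ.le hη.1
  have hle : β * η ≤ β := mul_le_of_le_one_right hβ.le hη.2
  have h1 := h (β * η) (by rw [abs_of_nonneg hη']; linarith)
  have h2 := hc.tangent_le hd 0 (β * η)
  rw [hV0] at h2
  rw [abs_of_nonneg hη', abs_le] at h1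
  rw [div_le_iff₀ (by positivity)]
  nlinarith [mul_nonneg hη' (by linarith : 0 ≤ 3 / 2 * (β * η) - deriv V (β * η)),
    mul_le_mul hle hle hη' hβ.le]

/-- Fix `b > 0` and `λ ∈ ℝ`. Under Assumption 2.1 on `V`, there exist `C > 0` and
`β_c ∈ (0,1]` such that for all `β ∈ (0, β_c)` the Gibbs measure is well defined and
`∫ |β⁻¹ V'(βη) - η - (1/2) V'''(0) β η²| dν_{β,b,λ}(η) ≤ C β²`: the Taylor expansion
error of `ξ = β⁻¹ V'(βη)` has expectation of order `β²` uniformly for small `β`. -/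
theorem taylor_error_expectation_bound
    (V : ℝ → ℝ) (γV M : ℝ) (hγV : 0 < γV) (hM : 0 < M)
    (hsmooth : ContDiff ℝ (⊤ : ℕ∞) V) (hconv : ConvexOn ℝ Set.univ V)
    (hnonneg : ∀ x : ℝ, 0 ≤ V x) (hV0 : V 0 = 0) (hV'0 : deriv V 0 = 0)
    (hV''0 : iteratedDeriv 2 V 0 = 1)
    (hgrowth : ∀ k : ℕ, k ≤ 5 → ∀ x : ℝ, |iteratedDeriv k V x| ≤ M * Real.exp (γV * |x|))
    (b lam : ℝ) (hb : 0 < b) :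
    ∃ C > (0 : ℝ), ∃ βc ∈ Set.Ioc (0 : ℝ) 1, ∀ β ∈ Set.Ioo (0 : ℝ) βc,
      Integrable (gibbsDensity V β b lam) ∧
      (∫⁻ η : ℝ, ENNReal.ofReal
          |deriv V (β * η) / β - η - (1 / 2) * iteratedDeriv 3 V 0 * β * η ^ 2|
          ∂(gibbsMeasure V β b lam))
        ≤ ENNReal.ofReal (C * β ^ 2) := by
  have hγ := hγV.le
  have hV1 : ContDiff ℝ (⊤ : ℕ∞) (deriv V) := (contDiff_infty_iff_deriv.mp hsmooth).2
  have d0 : Differentiable ℝ V := hsmooth.differentiable (by simp)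
  have d1 : Differentiable ℝ (deriv V) := hV1.differentiable (by simp)
  have h2 : deriv (deriv V) 0 = 1 := by
    simpa [iteratedDeriv_succ, iteratedDeriv_zero] using hV''0
  have h4 : ∀ x, |deriv (deriv (deriv (deriv V))) x| ≤ M * Real.exp (γV * |x|) := fun x => by
    simpa [iteratedDeriv_succ, iteratedDeriv_zero] using hgrowth 4 (by norm_num) x
  have h3 : iteratedDeriv 3 V 0 = deriv (deriv (deriv V)) 0 := by
    simp [iteratedDeriv_succ, iteratedDeriv_zero]
  obtain ⟨δ, hδ, hδV⟩ := exists_abs_deriv_sub_self_le (d1 0) hV'0 h2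
  obtain ⟨R, hR, hbR⟩ : ∃ R > 0, b * R / 2 = |lam| + γV + 2 :=
    ⟨2 * (|lam| + γV + 2) / b, by positivity, by field_simp⟩
  set A : ℝ := Real.exp (3 / 2 * b * R ^ 2) with hA
  have hApos : 0 < A := Real.exp_pos _
  set z : ℝ := Real.exp (-(3 / 2 * b + |lam|)) with hz
  have hzpos : 0 < z := Real.exp_pos _
  set I : ℝ := ∫ x : ℝ, Real.exp (-|x|) with hI
  have hIpos : 0 ≤ I := integral_nonneg fun x => (Real.exp_pos _).le
  refine ⟨6 * M * A / z * I + 1, by positivity, min 1 (δ / (R + 1)),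
    ⟨by positivity, min_le_left _ _⟩, fun β hβ => ?_⟩
  have hβ0 : 0 < β := hβ.1
  have hβ1 : β ≤ 1 := (hβ.2.trans_le (min_le_left _ _)).le
  have hβδ : β * (R + 1) < δ := (lt_div_iff₀ (by positivity)).mp
    (hβ.2.trans_le (min_le_right _ _))
  have hpos : ∀ η, 0 < gibbsDensity V β b lam η := fun η => Real.exp_pos _
  have hcont : Continuous (gibbsDensity V β b lam) := by
    have := d0.continuous
    unfold gibbsDensity
    fun_prop
  have hupper : ∀ η, gibbsDensity V β b lam η ≤ A * Real.exp (-((γV + 2) * |η|)) := by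
    intro η
    rw [hA, ← Real.exp_add]
    refine Real.exp_le_exp.mpr ?_
    have key := linear_le_rescaled hconv d0 hnonneg hR hβ0 (by nlinarith) hδV η
    have hl : lam * η ≤ |lam| * |η| := (le_abs_self _).trans (abs_mul _ _).le
    have := mul_le_mul_of_nonneg_left key hb.le
    have e : b * (R * |η| / 2 - 3 / 2 * R ^ 2)
        = (|lam| + γV + 2) * |η| - 3 / 2 * b * R ^ 2 := by rw [← hbR]; ring
    rw [e] at this
    linarith
  have hint : Integrable (gibbsDensity V β b lam) := by
    refine (integrable_exp_neg_abs.const_mul A).mono' hcont.aestronglyMeasurable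
      (Filter.Eventually.of_forall fun η => ?_)
    rw [Real.norm_of_nonneg (hpos η).le]
    refine (hupper η).trans ?_
    gcongr
    nlinarith [abs_nonneg η]
  have hZ : z ≤ partitionZ V β b lam := by
    calc z = ∫ _ in Set.Icc (0 : ℝ) 1, z := by simp
      _ ≤ ∫ η in Set.Icc (0 : ℝ) 1, gibbsDensity V β b lam η := by
        refine setIntegral_mono_on (by simp) hint.integrableOn measurableSet_Icc fun η hη => ?_
        refine Real.exp_le_exp.mpr ?_
        have key := rescaled_le hconv d0 hV0 hβ0 (by nlinarith) hδV hη
        have hl : -|lam| ≤ lam * η := by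
          have : |lam * η| ≤ |lam| := by
            rw [abs_mul, abs_of_nonneg hη.1]
            exact mul_le_of_le_one_right (abs_nonneg _) hη.2
          linarith [neg_abs_le (lam * η)]
        nlinarith
      _ ≤ partitionZ V β b lam :=
        setIntegral_le_integral hint (Filter.Eventually.of_forall fun η => (hpos η).le)
  have hZpos : 0 < partitionZ V β b lam := hzpos.trans_le hZ
  have herr : ∀ η, |deriv V (β * η) / β - η - 1 / 2 * iteratedDeriv 3 V 0 * β * η ^ 2|
      ≤ 6 * M * β ^ 2 * Real.exp ((γV + 1) * |η|) := by
    intro η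
    have key := abs_taylor_two_error_le hV1 hM.le hγ h4 (β * η)
    rw [hV'0, h2] at key
    have e : deriv V (β * η) / β - η - 1 / 2 * iteratedDeriv 3 V 0 * β * η ^ 2
        = (deriv V (β * η) - 0 - 1 * (β * η)
            - 1 / 2 * deriv (deriv (deriv V)) 0 * (β * η) ^ 2) / β := by
      rw [h3]
      field_simp
      ring
    rw [e, abs_div, abs_of_pos hβ0, div_le_iff₀ hβ0]
    refine key.trans ?_
    have hexp : |η| ^ 3 ≤ 6 * Real.exp |η| := by
      have := Real.pow_div_factorial_le_exp |η| (abs_nonneg η) 3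
      norm_num [Nat.factorial] at this
      linarith
    have habs : |β * η| = β * |η| := by rw [abs_mul, abs_of_pos hβ0]
    rw [habs]
    calc M * Real.exp (γV * (β * |η|)) * (β * |η|) ^ 3
        = M * β ^ 3 * (Real.exp (γV * (β * |η|)) * |η| ^ 3) := by ring
      _ ≤ M * β ^ 3 * (Real.exp (γV * |η|) * (6 * Real.exp |η|)) := by
        gcongr
        exact mul_le_of_le_one_left (abs_nonneg _) hβ1
      _ = 6 * M * β ^ 2 * Real.exp ((γV + 1) * |η|) * β := by
        rw [add_mul, one_mul, Real.exp_add]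
        ring
  refine ⟨hint, ?_⟩
  calc _ ≤ ∫⁻ η : ℝ, ENNReal.ofReal (gibbsDensity V β b lam η / partitionZ V β b lam) *
        ENNReal.ofReal |deriv V (β * η) / β - η - 1 / 2 * iteratedDeriv 3 V 0 * β * η ^ 2| :=
        lintegral_withDensity_le_lintegral_mul _
          (hcont.measurable.div_const _).ennreal_ofReal _
    _ ≤ ∫⁻ η : ℝ, ENNReal.ofReal (6 * M * A / z * β ^ 2 * Real.exp (-|η|)) := by
        refine lintegral_mono fun η => ?_
        rw [← ENNReal.ofReal_mul (div_nonneg (hpos η).le hZpos.le)]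
        refine ENNReal.ofReal_le_ofReal ?_
        calc _ ≤ A * Real.exp (-((γV + 2) * |η|)) / z *
              (6 * M * β ^ 2 * Real.exp ((γV + 1) * |η|)) := by
              gcongr
              · exact hupper η
              · exact herr η
          _ = 6 * M * A / z * β ^ 2 *
              (Real.exp (-((γV + 2) * |η|)) * Real.exp ((γV + 1) * |η|)) := by ring
          _ = _ := by
              rw [← Real.exp_add]
              ring_nf
    _ = ENNReal.ofReal (6 * M * A / z * β ^ 2 * I) := by
        rw [← ofReal_integral_eq_lintegral_ofReal (integrable_exp_neg_abs.const_mul _)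
          (Filter.Eventually.of_forall fun η => by positivity), integral_const_mul]
    _ ≤ _ := by
        refine ENNReal.ofReal_le_ofReal ?_
        nlinarith [sq_nonneg β]
end
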